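/- Under linear driving δ(t) = δ_max − (ε/τ)t with ε = δ_max − δ_min, one has exp(−κ ∫₀^τ γ_T(δ(t)) dt) = (Z_T(δ_min)/Z_T(δ_max))^{−κτT/ε}, where the right-hand side uses the real power function. Consequently the continuous-time probability of zero work is Pr[W = 0] = (1 − p₀) (Z_T(δ_min)/Z_T(δ_max))^{−κτT/ε}. -/

import Mathlib

open Set

/-- under linear driving `δ(t) = δmax − (ε/τ) t` with `ε = δmax − δmin`,
`exp(−κ ∫₀^τ γ_T(δ(t)) dt) = (Z(δmin)/Z(δmax))^{−κτT/ε}` (real power), where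
`γ_T(δ) = 1/(1 + exp(δ/T))` and `Z(δ) = 1 + exp(−δ/T)`; consequently the
continuous-time probability of zero work is
`(1 − p₀) (Z(δmin)/Z(δmax))^{−κτT/ε}`. -/
theorem stmt8 (T δmin δmax τ κ p₀ : ℝ)
    (hT : 0 < T) (hmin : 0 < δmin) (hlt : δmin < δmax) (hτ : 0 < τ) (hκ : 0 < κ)
    (hp₀ : p₀ ∈ Icc (0 : ℝ) 1) :
    Real.exp (-(κ * ∫ t in (0 : ℝ)..τ,
        1 / (1 + Real.exp ((δmax - (δmax - δmin) / τ * t) / T)))) =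
      ((1 + Real.exp (-δmin / T)) / (1 + Real.exp (-δmax / T))) ^
        (-(κ * τ * T / (δmax - δmin))) ∧
    (1 - p₀) * Real.exp (-(κ * ∫ t in (0 : ℝ)..τ,
        1 / (1 + Real.exp ((δmax - (δmax - δmin) / τ * t) / T)))) =
      (1 - p₀) * ((1 + Real.exp (-δmin / T)) / (1 + Real.exp (-δmax / T))) ^
        (-(κ * τ * T / (δmax - δmin))) := by
  have hε : 0 < δmax - δmin := sub_pos.2 hlt
  have hderiv : ∀ t : ℝ, HasDerivAt
      (fun t : ℝ => τ * T / (δmax - δmin) *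
        Real.log (1 + Real.exp (-(δmax - (δmax - δmin) / τ * t) / T)))
      (1 / (1 + Real.exp ((δmax - (δmax - δmin) / τ * t) / T))) t := by
    intro t
    have h1 : HasDerivAt (fun t : ℝ => -(δmax - (δmax - δmin) / τ * t) / T)
        ((δmax - δmin) / τ / T) t := by
      have h := ((((hasDerivAt_id t).const_mul ((δmax - δmin) / τ)).const_sub δmax).neg).div_const T
      refine h.congr_deriv ?_
      simp
    have hpos : 0 < 1 + Real.exp (-(δmax - (δmax - δmin) / τ * t) / T) := by positivity
    have h2 := ((h1.exp.const_add 1).log hpos.ne').const_mul (τ * T / (δmax - δmin))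
    refine h2.congr_deriv ?_
    rw [neg_div, Real.exp_neg]
    have hE := Real.exp_pos ((δmax - (δmax - δmin) / τ * t) / T)
    generalize Real.exp ((δmax - (δmax - δmin) / τ * t) / T) = E at hE
    generalize δmax - δmin = e at hε
    field_simp
    try ring
  have hcont : Continuous (fun t : ℝ =>
      1 / (1 + Real.exp ((δmax - (δmax - δmin) / τ * t) / T))) := by
    refine continuous_const.div (by fun_prop) (fun t => ?_)
    positivity
  have hint := intervalIntegral.integral_eq_sub_of_hasDerivAt (a := 0) (b := τ)
    (fun t _ => hderiv t) (hcont.intervalIntegrable 0 τ)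
  have e1 : δmax - (δmax - δmin) / τ * τ = δmin := by
    field_simp
    ring
  have key : Real.exp (-(κ * ∫ t in (0 : ℝ)..τ,
        1 / (1 + Real.exp ((δmax - (δmax - δmin) / τ * t) / T)))) =
      ((1 + Real.exp (-δmin / T)) / (1 + Real.exp (-δmax / T))) ^
        (-(κ * τ * T / (δmax - δmin))) := by
    rw [hint, Real.rpow_def_of_pos (by positivity),
      Real.log_div (by positivity) (by positivity), e1, mul_zero, sub_zero]
    congr 1
    ring
  exact ⟨key, by rw [key]⟩
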